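/- Let μ > 0 and for each integer N ≥ 1 set ℏ = ℏ_N := μ/N. Then for every point (x,p) ∈ ℝ² in the classically forbidden region, i.e. with x² + p² ≥ 2μ, one has the pointwise limit lim_{N→∞} [σ_{P_{<N}}^{ℏ_N}(x,p) − χ_D^{(N)}(x,p)] = 0. -/

import Mathlib

open MeasureTheory Filter

/-- Physicists' Hermite polynomial `h_k(y) = (-1)^k e^{y^2} (d/dy)^k e^{-y^2}`. -/
noncomputable def hermiteH (k : ℕ) (y : ℝ) : ℝ :=
  (-1)^k * Real.exp (y^2) * iteratedDeriv k (fun t => Real.exp (-t^2)) y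

/-- Hermite function `ψ_k^ℏ`. -/
noncomputable def psiH (hbar : ℝ) (k : ℕ) (x : ℝ) : ℝ :=
  (Real.sqrt (Real.sqrt Real.pi * 2^k * (Nat.factorial k) * Real.sqrt hbar))⁻¹ *
    Real.exp (-x^2 / (2*hbar)) * hermiteH k (x / Real.sqrt hbar)

/-- Kernel of the spectral projection `P_{<N}`. -/
noncomputable def KerK (hbar : ℝ) (N : ℕ) (u v : ℝ) : ℝ :=
  ∑ k ∈ Finset.range N, psiH hbar k u * psiH hbar k v

/-- Kernel of the Zeno Hamiltonian `H_N = P_{<N} p̂ P_{<N}`. -/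
noncomputable def KerQ (hbar : ℝ) (N : ℕ) (u v : ℝ) : ℂ :=
  Complex.I * (Real.sqrt (hbar/2) : ℂ) *
    ∑ j ∈ Finset.range (N-1), ((Real.sqrt ((j:ℝ)+1) : ℝ) : ℂ) *
      ((psiH hbar (j+1) u * psiH hbar j v - psiH hbar j u * psiH hbar (j+1) v : ℝ) : ℂ)

/-- Weyl symbol of `P_{<N}`. -/
noncomputable def sigmaP (hbar : ℝ) (N : ℕ) (x p : ℝ) : ℂ :=
  ∫ y : ℝ, ((hbar * KerK hbar N (x - hbar*y/2) (x + hbar*y/2) : ℝ) : ℂ) *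
    Complex.exp (Complex.I * (p:ℂ) * (y:ℂ))

/-- Weyl symbol of `H_N`. -/
noncomputable def sigmaH (hbar : ℝ) (N : ℕ) (x p : ℝ) : ℂ :=
  ∫ y : ℝ, (hbar : ℂ) * KerQ hbar N (x - hbar*y/2) (x + hbar*y/2) *
    Complex.exp (Complex.I * (p:ℂ) * (y:ℂ))
/-- Airy function via the contour integral along `Re ζ = 1`:
`Ai(z) = (1/(2πi)) ∫ e^{ζ³/3 - zζ} dζ`, parametrised by `ζ = 1 + it`. -/
noncomputable def AiryC (z : ℂ) : ℂ :=
  (1 / (2 * (Real.pi : ℂ))) *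
    ∫ t : ℝ, Complex.exp ((1 + (t:ℂ)*Complex.I)^3/3 - z*(1 + (t:ℂ)*Complex.I))

/-- The Airy function on the real line (real-valued). -/
noncomputable def AiryR (x : ℝ) : ℝ := (AiryC (x:ℂ)).re

/-- Integrated Airy function `Ai₁(ξ) = ∫_ξ^∞ Ai(u) du`. -/
noncomputable def Ai1 (ξ : ℝ) : ℝ := ∫ u in Set.Ioi ξ, AiryR u

/-- The smoothed indicator `χ_D^{(N)}(x,p) = Ai₁((2N)^{2/3}(x²+p²-2μ)/(2μ))`. -/
noncomputable def chiDN (μ : ℝ) (N : ℕ) (x p : ℝ) : ℝ :=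
  Ai1 ((2*(N:ℝ)) ^ ((2:ℝ)/3) * (x^2 + p^2 - 2*μ) / (2*μ))

/-! ### Hermite polynomials -/

noncomputable def HR : ℕ → Polynomial ℝ
  | 0 => 1
  | (k+1) => 2 * Polynomial.X * HR k - Polynomial.derivative (HR k)

theorem HR_deriv (k : ℕ) : Polynomial.derivative (HR k) = (2 * (k:Polynomial ℝ)) * HR (k-1) := by
  induction k with
  | zero => simp [HR]
  | succ k ih =>
    rw [HR]
    rw [Polynomial.derivative_sub, Polynomial.derivative_mul, ih]
    rcases k with _ | k
    · simp [HR]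
    · simp only [Nat.add_sub_cancel, HR] at *
      simp only [Polynomial.derivative_mul, Polynomial.derivative_X, Polynomial.derivative_ofNat, Polynomial.derivative_natCast]
      push_cast
      ring

theorem iter_gauss (k : ℕ) : iteratedDeriv k (fun t : ℝ => Real.exp (-t^2)) =
    fun y => (-1)^k * (HR k).eval y * Real.exp (-y^2) := by
  induction k with
  | zero => ext y; simp [HR]
  | succ k ih =>
    rw [iteratedDeriv_succ, ih]
    ext y
    have h1 : HasDerivAt (fun y : ℝ => Real.exp (-y^2)) (Real.exp (-y^2) * (-(2*y))) y := by
      have := ((hasDerivAt_pow 2 y).neg).exp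
      simpa using this
    have h2 := (((HR k).hasDerivAt y).const_mul ((-1:ℝ)^k)).mul h1
    have h3 := h2.deriv
    simp only [HR, Polynomial.eval_sub, Polynomial.eval_mul, Polynomial.eval_X, Polynomial.eval_ofNat]
    refine Eq.trans ?_ (h3.trans ?_)
    · rfl
    · rw [pow_succ]; ring

theorem hermiteH_eq (k : ℕ) (y : ℝ) : hermiteH k y = (HR k).eval y := by
  unfold hermiteH
  rw [iter_gauss]
  have : Real.exp (y^2) * Real.exp (-y^2) = 1 := by rw [← Real.exp_add]; simp
  have h2 : ((-1:ℝ)^k) * (-1)^k = 1 := by rw [← mul_pow]; simp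
  calc _ = (((-1:ℝ)^k) * (-1)^k) * (Real.exp (y^2) * Real.exp (-y^2)) * (HR k).eval y := by ring
    _ = _ := by rw [this, h2]; ring

noncomputable def HC (k : ℕ) : Polynomial ℂ := (HR k).map Complex.ofRealHom

theorem HC_zero : HC 0 = 1 := by simp [HC, HR]
theorem HC_succ (k : ℕ) : HC (k+1) = 2 * Polynomial.X * HC k - Polynomial.derivative (HC k) := by
  simp [HC, HR, Polynomial.derivative_map]
theorem HC_deriv (k : ℕ) : Polynomial.derivative (HC k) = (2 * (k:Polynomial ℂ)) * HC (k-1) := by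
  simp [HC, Polynomial.derivative_map, HR_deriv]
theorem HC_eval (k : ℕ) (y : ℝ) : (HC k).eval (y:ℂ) = (hermiteH k y : ℂ) := by
  rw [hermiteH_eq, HC, Polynomial.eval_map]
  exact Polynomial.eval₂_at_apply Complex.ofRealHom y

/-! ### Gaussian functional -/

noncomputable def gw (P : ℝ) (y : ℝ) : ℂ := Complex.exp (-(y:ℂ)^2 + 2 * Complex.I * P * y)

theorem gw_norm (P y : ℝ) : ‖gw P y‖ = Real.exp (-y^2) := by
  rw [gw, Complex.norm_exp]
  congr 1
  simp [← Complex.ofReal_pow]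

theorem gw_cont (P : ℝ) : Continuous (gw P) := by
  unfold gw; fun_prop

theorem gw_int_pow (P : ℝ) (n : ℕ) : Integrable (fun y : ℝ => (y:ℂ)^n * gw P y) := by
  have h := integrable_rpow_mul_exp_neg_mul_sq (b := 1) one_pos (s := n) (by linarith [n.cast_nonneg (α := ℝ)])
  refine h.norm.mono' (by have := gw_cont P; fun_prop) ?_
  filter_upwards with y
  simp only [norm_mul, norm_pow, gw_norm, Real.rpow_natCast, Complex.norm_real, Real.norm_eq_abs, Real.abs_exp]
  apply le_of_eq; congr 2; ring

theorem gw_int (P : ℝ) (q : Polynomial ℂ) : Integrable (fun y : ℝ => q.eval (y:ℂ) * gw P y) := by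
  induction q using Polynomial.induction_on' with
  | add p q hp hq =>
    simp only [Polynomial.eval_add, add_mul]; exact hp.add hq
  | monomial n a =>
    simp only [Polynomial.eval_monomial, mul_assoc]; exact (gw_int_pow P n).const_mul a

noncomputable def Lf (P : ℝ) (q : Polynomial ℂ) : ℂ := ∫ y : ℝ, q.eval (y:ℂ) * gw P y

theorem Lf_add (P : ℝ) (p q : Polynomial ℂ) : Lf P (p + q) = Lf P p + Lf P q := by
  unfold Lf
  rw [← integral_add (gw_int P p) (gw_int P q)]
  simp [add_mul]
theorem Lf_sub (P : ℝ) (p q : Polynomial ℂ) : Lf P (p - q) = Lf P p - Lf P q := by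
  unfold Lf
  rw [← integral_sub (gw_int P p) (gw_int P q)]
  simp [sub_mul]
theorem Lf_C (P : ℝ) (a : ℂ) (q : Polynomial ℂ) : Lf P (Polynomial.C a * q) = a * Lf P q := by
  unfold Lf
  rw [← integral_const_mul]
  simp [mul_assoc]

theorem Lf_X (P : ℝ) (q : Polynomial ℂ) :
    2 * Lf P (Polynomial.X * q) = 2 * Complex.I * P * Lf P q + Lf P (Polynomial.derivative q) := by
  have hd : ∀ y : ℝ, HasDerivAt (fun y : ℝ => q.eval (y:ℂ) * gw P y)
      ((Polynomial.derivative q + (Polynomial.C (2*Complex.I*P) * q - Polynomial.C 2 * (Polynomial.X * q))).eval (y:ℂ) * gw P y) y := by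
    intro y
    have h1 : HasDerivAt (fun y : ℝ => q.eval (y:ℂ)) ((Polynomial.derivative q).eval (y:ℂ)) y :=
      (q.hasDerivAt (y:ℂ)).comp_ofReal
    have h2 : HasDerivAt (fun w : ℂ => Complex.exp (-w^2 + 2 * Complex.I * P * w))
        (Complex.exp (-(y:ℂ)^2 + 2 * Complex.I * P * y) * (-(2*(y:ℂ)) + 2 * Complex.I * P)) (y:ℂ) := by
      have := (((hasDerivAt_pow 2 (y:ℂ)).neg).add ((hasDerivAt_id (y:ℂ)).const_mul (2*Complex.I*P))).cexp
      simpa using this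
    have h3 : HasDerivAt (gw P) _ y := h2.comp_ofReal
    refine (h1.mul h3).congr_deriv ?_
    simp [gw]; ring
  have h0 := integral_eq_zero_of_hasDerivAt_of_integrable hd (gw_int P _) (gw_int P _)
  change Lf P _ = 0 at h0
  rw [Lf_add, Lf_sub, Lf_C, Lf_C] at h0
  linear_combination -h0

theorem Lf_one (P : ℝ) : Lf P 1 = (Real.sqrt Real.pi : ℂ) * Complex.exp (-(P:ℂ)^2) := by
  unfold Lf gw
  have := integral_cexp_quadratic (b := -1) (by simp) (2*Complex.I*P) 0
  simp only [Polynomial.eval_one, one_mul]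
  convert this using 2
  · ext y; congr 1; ring
  · rw [neg_neg, div_one, Real.sqrt_eq_rpow, Complex.ofReal_cpow Real.pi_pos.le]; push_cast; rfl
  · congr 1; ring_nf; simp

noncomputable def Ijk (X P : ℝ) (j k : ℕ) : ℂ :=
  Lf P ((HC j).comp (Polynomial.C (X:ℂ) - Polynomial.X) * (HC k).comp (Polynomial.C (X:ℂ) + Polynomial.X))

theorem hC2 : Polynomial.C (2:ℂ) = 2 := rfl

theorem Ijk_succ (X P : ℝ) (j k : ℕ) :
    Ijk X P j (k+1) = 2 * (X + Complex.I * P) * Ijk X P j k - 2 * j * Ijk X P (j-1) k := by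
  unfold Ijk
  set a : Polynomial ℂ := Polynomial.C (X:ℂ) - Polynomial.X with ha
  set b : Polynomial ℂ := Polynomial.C (X:ℂ) + Polynomial.X with hb
  have hx := Lf_X P ((HC j).comp a * (HC k).comp b)
  have hdq : Polynomial.derivative ((HC j).comp a * (HC k).comp b) =
      (HC j).comp a * (Polynomial.derivative (HC k)).comp b - Polynomial.C (2*(j:ℂ)) * ((HC (j-1)).comp a * (HC k).comp b) := by
    rw [Polynomial.derivative_mul, Polynomial.derivative_comp, Polynomial.derivative_comp, HC_deriv j]
    simp [ha, hb, hC2]; ring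
  rw [hdq, Lf_sub, Lf_C] at hx
  have e : (HC j).comp a * (HC (k+1)).comp b = Polynomial.C (2*(X:ℂ)) * ((HC j).comp a * (HC k).comp b)
    + Polynomial.C 2 * (Polynomial.X * ((HC j).comp a * (HC k).comp b)) - (HC j).comp a * (Polynomial.derivative (HC k)).comp b := by
    rw [HC_succ]; simp [hb, hC2]; ring
  rw [e, Lf_sub, Lf_add, Lf_C, Lf_C, hx]
  ring

theorem Ijk_zero (X P : ℝ) (j : ℕ) :
    Ijk X P j 0 = (2 * (X - Complex.I * P))^j * Lf P 1 := by
  induction j with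
  | zero => simp [Ijk, HC_zero]
  | succ j ih =>
  rw [pow_succ, mul_right_comm, ← ih]
  unfold Ijk
  set a : Polynomial ℂ := Polynomial.C (X:ℂ) - Polynomial.X with ha
  simp only [HC_zero, Polynomial.one_comp, mul_one]
  have hx := Lf_X P ((HC j).comp a)
  have hdq : Polynomial.derivative ((HC j).comp a) = Polynomial.C (-1) * ((Polynomial.derivative (HC j)).comp a) := by
    rw [Polynomial.derivative_comp]; simp [ha]
  rw [hdq, Lf_C] at hx
  have e : (HC (j+1)).comp a = Polynomial.C (2*(X:ℂ)) * ((HC j).comp a)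
    - Polynomial.C 2 * (Polynomial.X * ((HC j).comp a)) - (Polynomial.derivative (HC j)).comp a := by
    rw [HC_succ]; simp [ha, hC2]; ring
  rw [e, Lf_sub, Lf_sub, Lf_C, Lf_C, hx]
  ring

theorem closed_form (a b : ℂ) (F : ℕ → ℕ → ℂ) (h0 : ∀ j, F 0 j = b^j)
    (hs : ∀ k j, F (k+1) j = a * F k j - 2 * j * F k (j-1)) (k j : ℕ) :
    F k j = ∑ m ∈ Finset.range (k+1), (-2)^m * (m.factorial * j.choose m * k.choose m : ℕ) * a^(k-m) * b^(j-m) := by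
  induction k generalizing j with
  | zero => simp [h0]
  | succ k ih =>
    rw [hs, ih, ih]
    have e1 : a * ∑ m ∈ Finset.range (k+1), (-2)^m * ((m.factorial * j.choose m * k.choose m : ℕ):ℂ) * a^(k-m) * b^(j-m)
       = ∑ m ∈ Finset.range (k+2), (-2)^m * ((m.factorial * j.choose m * k.choose m : ℕ):ℂ) * a^(k+1-m) * b^(j-m) := by
      rw [Finset.sum_range_succ _ (k+1), Nat.choose_succ_self, Finset.mul_sum]
      simp only [mul_zero, Nat.cast_zero, zero_mul, add_zero]
      apply Finset.sum_congr rfl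
      intro m hm
      have : k + 1 - m = (k - m) + 1 := by have := Finset.mem_range.1 hm; omega
      rw [this, pow_succ]; ring
    rw [e1, Finset.sum_range_succ' _ (k+1), Finset.sum_range_succ' _ (k+1), Finset.mul_sum]
    have e2 : ∀ m, (-2:ℂ)^(m+1) * (((m+1).factorial * j.choose (m+1) * (k+1).choose (m+1) : ℕ):ℂ) * a^(k+1-(m+1)) * b^(j-(m+1))
      = (-2)^(m+1) * (((m+1).factorial * j.choose (m+1) * k.choose (m+1) : ℕ):ℂ) * a^(k+1-(m+1)) * b^(j-(m+1))
       - 2 * j * ((-2)^m * ((m.factorial * (j-1).choose m * k.choose m : ℕ):ℂ) * a^(k-m) * b^(j-1-m)) := by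
      intro m
      have hc : (m+1) * j.choose (m+1) = j * (j-1).choose m := by
        rcases j with _ | j
        · simp
        · have := Nat.add_one_mul_choose_eq j m
          simp only [Nat.add_sub_cancel]; linarith
      have hc' : ((m:ℂ)+1) * j.choose (m+1) = j * (j-1).choose m := by exact_mod_cast hc
      rw [Nat.choose_succ_succ k m, Nat.factorial_succ, show k+1-(m+1) = k - m by omega, show j-(m+1) = j-1-m by omega]
      push_cast
      rw [pow_succ]
      linear_combination (-2)^m * (-2) * (m.factorial:ℂ) * (k.choose m) * a^(k-m) * b^(j-1-m) * hc'
    simp only [e2, Finset.sum_sub_distrib]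
    simp
    ring

/-- signed Laguerre -/
noncomputable def cL (z : ℂ) (k : ℕ) : ℂ :=
  ∑ n ∈ Finset.range (k+1), (-1)^(k-n) * (k.choose n) * z^n / n.factorial

theorem Ijk_diag (X P : ℝ) (k : ℕ) :
    Ijk X P k k = 2^k * k.factorial * cL ((2*(X^2+P^2) : ℝ)) k * Lf P 1 := by
  have h1 : ∀ k j, Ijk X P j k = Lf P 1 * ∑ m ∈ Finset.range (k+1), (-2)^m * (m.factorial * j.choose m * k.choose m : ℕ) *
     (2 * (X + Complex.I * P))^(k-m) * (2 * (X - Complex.I * P))^(j-m) := by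
    have hL : Lf P 1 ≠ 0 := by
      rw [Lf_one]
      refine mul_ne_zero ?_ (Complex.exp_ne_zero _)
      exact_mod_cast (Real.sqrt_pos.2 Real.pi_pos).ne'
    intro k j
    have := closed_form (2 * (X + Complex.I * P)) (2 * (X - Complex.I * P)) (fun k j => Ijk X P j k / Lf P 1)
      (fun j => by rw [Ijk_zero]; field_simp) (fun k j => by simp only [Ijk_succ]; ring) k j
    rw [← this]; field_simp
  rw [h1, mul_comm]
  congr 1
  rw [cL, Finset.mul_sum, ← Finset.sum_range_reflect]
  apply Finset.sum_congr rfl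
  intro n hn
  have hn' : n ≤ k := by have := Finset.mem_range.1 hn; omega
  have e : k + 1 - 1 - n = k - n := by omega
  rw [e, Nat.choose_symm hn', Nat.sub_sub_self hn', mul_assoc, ← mul_pow]
  have e3 : (2 * ((X:ℂ) + Complex.I * P)) * (2 * (X - Complex.I * P)) = 2 * ((2*(X^2+P^2) : ℝ):ℂ) := by
    push_cast; linear_combination (-4 * (P:ℂ)^2) * Complex.I_sq
  rw [e3, mul_pow]
  have hf : (n.factorial : ℂ) ≠ 0 := by exact_mod_cast n.factorial_ne_zero
  have hk : (2:ℂ)^k = 2^(k-n) * 2^n := by rw [← pow_add]; congr 1; omega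
  have hfac : (k.choose n : ℂ) * n.factorial * (k-n).factorial = k.factorial := by
    exact_mod_cast Nat.choose_mul_factorial_mul_factorial hn'
  rw [← hfac, hk, show (-2:ℂ) = (-1) * 2 by norm_num, mul_pow]
  push_cast
  field_simp

theorem term_eq (hbar : ℝ) (hh : 0 < hbar) (k : ℕ) (x p : ℝ) :
    (Integrable fun y : ℝ => ((hbar * (psiH hbar k (x - hbar*y/2) * psiH hbar k (x + hbar*y/2)) : ℝ) : ℂ) *
      Complex.exp (Complex.I * (p:ℂ) * (y:ℂ))) ∧
    ∫ y : ℝ, ((hbar * (psiH hbar k (x - hbar*y/2) * psiH hbar k (x + hbar*y/2)) : ℝ) : ℂ) *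
      Complex.exp (Complex.I * (p:ℂ) * (y:ℂ)) =
    2 * Complex.exp (-((x^2+p^2)/hbar : ℝ)) * cL ((2*((x^2+p^2)/hbar) : ℝ)) k := by
  set s := Real.sqrt hbar with hs
  have hs0 : 0 < s := Real.sqrt_pos.2 hh
  have hss : hbar = s^2 := (Real.sq_sqrt hh.le).symm
  set q := (HC k).comp (Polynomial.C ((x/s:ℝ):ℂ) - Polynomial.X) * (HC k).comp (Polynomial.C ((x/s:ℝ):ℂ) + Polynomial.X) with hq
  set K : ℝ := hbar * (Real.sqrt Real.pi * 2^k * (Nat.factorial k) * s)⁻¹ * Real.exp (-(x/s)^2) with hK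
  have hpt : (fun y : ℝ => ((hbar * (psiH hbar k (x - hbar*y/2) * psiH hbar k (x + hbar*y/2)) : ℝ) : ℂ) *
      Complex.exp (Complex.I * (p:ℂ) * (y:ℂ))) = fun y : ℝ => (K:ℂ) * (fun v : ℝ => q.eval (v:ℂ) * gw (p/s) v) ((s/2) * y) := by
    ext y
    have e1 : hbar * (psiH hbar k (x - hbar*y/2) * psiH hbar k (x + hbar*y/2)) =
        K * (hermiteH k (x/s - s/2*y) * hermiteH k (x/s+s/2*y)) * Real.exp (-(s/2*y)^2) := by
      unfold psiH
      rw [← hs]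
      have a1 : (x - hbar*y/2)/s = x/s - s/2*y := by rw [hss]; field_simp
      have a2 : (x + hbar*y/2)/s = x/s + s/2*y := by rw [hss]; field_simp
      have a3 : Real.exp (-(x - hbar*y/2)^2/(2*hbar)) * Real.exp (-(x + hbar*y/2)^2/(2*hbar)) =
          Real.exp (-(x/s)^2) * Real.exp (-(s/2*y)^2) := by
        rw [← Real.exp_add, ← Real.exp_add]; congr 1; rw [hss]; field_simp; ring
      have a4 : (Real.sqrt (Real.sqrt Real.pi * 2^k * (Nat.factorial k) * s))⁻¹ * (Real.sqrt (Real.sqrt Real.pi * 2^k * (Nat.factorial k) * s))⁻¹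
          = (Real.sqrt Real.pi * 2^k * (Nat.factorial k) * s)⁻¹ := by
        rw [← mul_inv, Real.mul_self_sqrt (by positivity)]
      rw [a1, a2, hK, ← a4]
      linear_combination hbar * ((Real.sqrt (Real.sqrt Real.pi * 2^k * (Nat.factorial k) * s))⁻¹ * (Real.sqrt (Real.sqrt Real.pi * 2^k * (Nat.factorial k) * s))⁻¹) * (hermiteH k (x/s - s/2*y) * hermiteH k (x/s+s/2*y)) * a3
    have e2 : q.eval ((s/2*y:ℝ):ℂ) = ((hermiteH k (x/s - s/2*y) * hermiteH k (x/s+s/2*y) : ℝ):ℂ) := by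
      rw [hq, Complex.ofReal_mul (hermiteH k _), ← HC_eval, ← HC_eval]
      simp
    have e3 : gw (p/s) (s/2*y) = ((Real.exp (-(s/2*y)^2) : ℝ):ℂ) * Complex.exp (Complex.I * (p:ℂ) * (y:ℂ)) := by
      rw [gw, Complex.ofReal_exp, ← Complex.exp_add]
      congr 1
      have : (s:ℂ) ≠ 0 := by exact_mod_cast hs0.ne'
      push_cast
      field_simp
    rw [e1]
    simp only [e2, e3]
    push_cast
    ring
  rw [hpt]
  refine ⟨((gw_int (p/s) q).comp_mul_left' (by positivity)).const_mul _, ?_⟩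
  rw [integral_const_mul, Measure.integral_comp_mul_left (fun v : ℝ => q.eval (v:ℂ) * gw (p/s) v) (s/2)]
  have hI : ∫ v : ℝ, q.eval (v:ℂ) * gw (p/s) v = Ijk (x/s) (p/s) k k := rfl
  rw [hI, Ijk_diag, Lf_one]
  have hz : (x/s)^2 + (p/s)^2 = (x^2+p^2)/hbar := by rw [hss]; field_simp
  rw [hz]
  have hex : Complex.exp (-((x^2+p^2)/hbar : ℝ)) = (Real.exp (-(x/s)^2):ℂ) * Complex.exp (-((p/s:ℝ):ℂ)^2) := by
    rw [← hz, Complex.ofReal_exp, ← Complex.exp_add]; congr 1; push_cast; ring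
  rw [hex, abs_of_pos (by positivity), hK, hss, Complex.real_smul]
  have h1 : (s:ℂ) ≠ 0 := by exact_mod_cast hs0.ne'
  have h2 : (Real.sqrt Real.pi:ℂ) ≠ 0 := by exact_mod_cast (Real.sqrt_pos.2 Real.pi_pos).ne'
  have h3 : (k.factorial : ℂ) ≠ 0 := by exact_mod_cast k.factorial_ne_zero
  push_cast
  field_simp

theorem sigmaP_eq (hbar : ℝ) (hh : 0 < hbar) (N : ℕ) (x p : ℝ) :
    sigmaP hbar N x p = 2 * Complex.exp (-((x^2+p^2)/hbar : ℝ)) *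
      ∑ k ∈ Finset.range N, cL ((2*((x^2+p^2)/hbar) : ℝ)) k := by
  unfold sigmaP KerK
  rw [Finset.mul_sum]
  rw [← Finset.sum_congr rfl (fun k _ => (term_eq hbar hh k x p).2)]
  rw [← integral_finsetSum _ (fun k _ => (term_eq hbar hh k x p).1)]
  congr 1
  ext y
  rw [Finset.mul_sum, Complex.ofReal_sum, Finset.sum_mul]

/-! ### Generating function and Cauchy extraction -/

theorem cL_hasSum (z t : ℂ) (ht : ‖t‖ < 1) :
    HasSum (fun k => cL z k * t^k) (Complex.exp (z*t/(1+t))/(1+t)) := by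
  have ht1 : (1:ℂ) + t ≠ 0 := by
    intro h
    have : t = -1 := by linear_combination h
    rw [this] at ht; simp at ht
  set f : ℕ × ℕ → ℂ := fun q => z^q.1/q.1.factorial * t^q.1 * (((q.2+q.1).choose q.1 : ℕ) * (-t)^q.2) with hf
  have hin : ∀ n, HasSum (fun l => f (n, l)) ((z*t/(1+t))^n / n.factorial * (1/(1+t))) := by
    intro n
    have h := (hasSum_choose_mul_geometric_of_norm_lt_one n (r := -t) (by simpa using ht)).mul_left (z^n/n.factorial * t^n)
    convert! h using 1
    rw [sub_neg_eq_add, div_pow, mul_pow, pow_succ]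
    field_simp
  have hout : HasSum (fun n : ℕ => (z*t/(1+t))^n / n.factorial * (1/(1+t))) (Complex.exp (z*t/(1+t))/(1+t)) := by
    have := (NormedSpace.expSeries_div_hasSum_exp (z*t/(1+t))).mul_right (1/(1+t))
    rw [← Complex.exp_eq_exp_ℂ] at this
    convert! this using 1
    ring
  have hsn : Summable (fun q => ‖f q‖) := by
    refine (summable_prod_of_nonneg (fun _ ↦ norm_nonneg _)).mpr ⟨fun n => ?_, ?_⟩
    · exact (hin n).summable.norm
    · have hb : ∀ n : ℕ, ∑' l, ‖f (n, l)‖ = (‖z‖*‖t‖/(1-‖t‖))^n / n.factorial * (1/(1-‖t‖)) := by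
        intro n
        have h := (hasSum_choose_mul_geometric_of_norm_lt_one n (r := ‖t‖) (by simpa using ht)).mul_left (‖z‖^n/n.factorial * ‖t‖^n)
        have h1 : (1:ℝ) - ‖t‖ ≠ 0 := by linarith
        have h2 := h.tsum_eq
        rw [show (fun l => ‖f (n,l)‖) = fun l : ℕ => ‖z‖^n/n.factorial * ‖t‖^n * (((l+n).choose n : ℕ) * ‖t‖^l) by
          ext l; simp [hf], h2, div_pow, mul_pow, pow_succ]
        field_simp
      simp only [hb]
      exact (Real.summable_pow_div_factorial _).mul_right _
  have hs : Summable f := hsn.of_norm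
  have hval : HasSum f (Complex.exp (z*t/(1+t))/(1+t)) := by
    have h1 := hs.hasSum.prod_fiberwise hin
    rw [hout.unique h1]
    exact hs.hasSum
  rw [← Finset.HasAntidiagonal.sigmaAntidiagonalEquivProd.hasSum_iff] at hval
  have h2 := hval.sigma (fun n => hasSum_fintype _)
  convert! h2 using 1
  ext k
  refine Eq.trans ?_ (Finset.sum_coe_sort (Finset.HasAntidiagonal.antidiagonal k) (fun q => f q)).symm
  rw [Finset.Nat.sum_antidiagonal_eq_sum_range_succ_mk, cL, Finset.sum_mul]
  apply Finset.sum_congr rfl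
  intro n hn
  have hn' : n ≤ k := by have := Finset.mem_range.1 hn; omega
  simp only [hf, Nat.sub_add_cancel hn']
  rw [neg_pow t, show t^k = t^n * t^(k-n) by rw [← pow_add]; congr 1; omega]
  ring

noncomputable def Gf (z t : ℂ) : ℂ := Complex.exp (z*t/(1+t))/(1+t) * (1-t)⁻¹

theorem S_hasSum (z t : ℂ) (ht : ‖t‖ < 1) :
    HasSum (fun n => (∑ k ∈ Finset.range (n+1), cL z k) * t^n) (Gf z t) := by
  have h1 := cL_hasSum z t ht
  have h2 := hasSum_geometric_of_norm_lt_one ht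
  have h := hasSum_sum_range_mul_of_summable_norm h1.summable.norm h2.summable.norm
  rw [h1.tsum_eq, h2.tsum_eq] at h
  convert! h using 1
  ext n
  rw [Finset.sum_mul]
  apply Finset.sum_congr rfl
  intro k hk
  have : k ≤ n := by have := Finset.mem_range.1 hk; omega
  rw [mul_assoc, ← pow_add]; congr 2; omega

theorem S_cauchy (z : ℂ) (n : ℕ) (ρ : ℝ) (h0 : 0 < ρ) (h1 : ρ < 1) :
    ∑ k ∈ Finset.range (n+1), cL z k =
      (2 * Real.pi * Complex.I : ℂ)⁻¹ • ∮ t in C(0, ρ), (t - 0)⁻¹ ^ n • (t - 0)⁻¹ • Gf z t := by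
  have hd : DifferentiableOn ℂ (Gf z) (Metric.closedBall 0 ρ) := by
    intro t ht
    have ht' : ‖t‖ < 1 := by
      have : ‖t‖ ≤ ρ := by simpa using ht
      linarith
    have e1 : (1:ℂ) + t ≠ 0 := by
      intro h
      have : t = -1 := by linear_combination h
      rw [this] at ht'; simp at ht'
    have e2 : (1:ℂ) - t ≠ 0 := by
      intro h
      have : t = 1 := by linear_combination -h
      rw [this] at ht'; simp at ht'
    unfold Gf
    apply DifferentiableAt.differentiableWithinAt
    fun_prop (disch := assumption)
  have hc := DifferentiableOn.hasFPowerSeriesOnBall (R := ⟨ρ, h0.le⟩) hd h0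
  have hp : HasFPowerSeriesAt (Gf z) (FormalMultilinearSeries.ofScalars ℂ (fun n => ∑ k ∈ Finset.range (n+1), cL z k)) 0 := by
    refine hasFPowerSeriesAt_iff.2 ?_
    filter_upwards [Metric.ball_mem_nhds (0:ℂ) one_pos] with t ht
    have := S_hasSum z t (by simpa using ht)
    simp only [FormalMultilinearSeries.coeff_ofScalars, smul_eq_mul, zero_add]
    convert! this using 1
    ext n
    ring
  have he := hp.eq_formalMultilinearSeries hc.hasFPowerSeriesAt
  have := congrArg (fun p => FormalMultilinearSeries.coeff p n) he
  simp only [FormalMultilinearSeries.coeff_ofScalars] at this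
  rw [this]
  simp [FormalMultilinearSeries.coeff, cauchyPowerSeries]
  rfl

/-! ### Contour parametrisation -/

noncomputable def wz (c τ : ℝ) : ℂ := c * (1 + τ * Complex.I)

noncomputable def FN (N : ℕ) (κ c τ : ℝ) : ℂ :=
  Complex.exp (2 * N * (wz c τ - κ * Complex.tanh (wz c τ))) * (2 * c / Complex.sinh (2 * wz c τ))

theorem FN_pt (n : ℕ) (κ : ℝ) (w : ℂ) (c : ℂ) (hw : 0 < w.re) :
    2 * Complex.exp (-(2 * ((n+1:ℕ):ℂ) * κ)) * (2 * c * ((Complex.exp (-2*w))⁻¹^n * Gf (4 * ((n+1:ℕ):ℂ) * κ) (Complex.exp (-2*w))))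
     = Complex.exp (2 * (n+1:ℕ) * (w - κ * Complex.tanh w)) * (2 * c / Complex.sinh (2 * w)) := by
  set t := Complex.exp (-2*w) with htd
  have ht' : ‖t‖ < 1 := by
    rw [htd, Complex.norm_exp]; simp [hw]
  have e1 : (1:ℂ) + t ≠ 0 := by
    intro h
    have : t = -1 := by linear_combination h
    rw [this] at ht'; simp at ht'
  have e2 : (1:ℂ) - t ≠ 0 := by
    intro h
    have : t = 1 := by linear_combination -h
    rw [this] at ht'; simp at ht'
  have e0 : t ≠ 0 := Complex.exp_ne_zero _
  have hE : Complex.exp w ≠ 0 := Complex.exp_ne_zero _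
  have hEt : t * (Complex.exp w)^2 = 1 := by
    rw [htd, ← Complex.exp_nat_mul, ← Complex.exp_add]; simp
  have htanh : Complex.tanh w = (1-t)/(1+t) := by
    have hte : t = ((Complex.exp w)^2)⁻¹ := by field_simp; exact hEt
    have e1' : (Complex.exp w)^2 + 1 ≠ 0 := by
      intro h; apply e1; rw [hte]; field_simp; rw [h, mul_zero]
    rw [Complex.tanh_eq_sinh_div_cosh, Complex.sinh, Complex.cosh, hte, Complex.exp_neg]
    field_simp
  have hsinh : Complex.sinh (2*w) = (t⁻¹ - t)/2 := by
    rw [Complex.sinh, htd, ← Complex.exp_neg]; congr 3 <;> ring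
  have hexp : Complex.exp (2 * (n+1:ℕ) * (w - κ * Complex.tanh w)) =
      t⁻¹^n * t⁻¹ * (Complex.exp (-(2 * ((n+1:ℕ):ℂ) * κ)) * Complex.exp (4 * ((n+1:ℕ):ℂ) * κ * t / (1+t))) := by
    rw [htanh, ← pow_succ, htd, ← Complex.exp_neg, ← Complex.exp_nat_mul, ← Complex.exp_add, ← Complex.exp_add, ← htd]
    congr 1
    field_simp
    ring
  rw [hexp, hsinh, Gf]
  have e3 : t⁻¹ - t ≠ 0 := by
    intro h
    have : (1-t)*(1+t) = 0 := by
      have : t * (t⁻¹ - t) = 0 := by rw [h]; simp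
      rw [mul_sub, mul_inv_cancel₀ e0] at this
      linear_combination this
    exact mul_ne_zero e2 e1 this
  have e4 : 1 - t^2 ≠ 0 := by
    intro h; exact mul_ne_zero e2 e1 (by linear_combination h)
  have e5 : t⁻¹ * (1/((t⁻¹ - t)/2)) = 2 * ((1+t)⁻¹ * (1-t)⁻¹) := by
    field_simp
    ring_nf
  linear_combination (-(2 * c * t⁻¹^n * Complex.exp (-(2 * ((n+1:ℕ):ℂ) * κ)) * Complex.exp (4 * ((n+1:ℕ):ℂ) * κ * t / (1+t)))) * e5

theorem S_integral (n : ℕ) (κ c : ℝ) (hc : 0 < c) :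
    2 * Complex.exp (-(2 * ((n+1:ℕ):ℂ) * κ)) * ∑ k ∈ Finset.range (n+1), cL (4 * ((n+1:ℕ):ℂ) * κ) k =
      (1 / (2 * (Real.pi:ℂ))) * ∫ τ in (-(Real.pi/(2*c)))..(Real.pi/(2*c)), FN (n+1) κ c τ := by
  rw [S_cauchy _ n (Real.exp (-2*c)) (Real.exp_pos _) (by rw [Real.exp_lt_one_iff]; linarith)]
  unfold circleIntegral
  set H : ℝ → ℂ := fun θ => (circleMap 0 (Real.exp (-2*c)) θ)⁻¹^n * Gf (4 * ((n+1:ℕ):ℂ) * κ) (circleMap 0 (Real.exp (-2*c)) θ) with hH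
  have h1 : ∀ θ : ℝ, deriv (circleMap 0 (Real.exp (-2*c))) θ •
      (fun t : ℂ => (t - 0)⁻¹ ^ n • (t - 0)⁻¹ • Gf (4 * ((n+1:ℕ):ℂ) * κ) t) (circleMap 0 (Real.exp (-2*c)) θ) = Complex.I * H θ := by
    intro θ
    have h0 : circleMap 0 (Real.exp (-2*c)) θ ≠ 0 := circleMap_ne_center (Real.exp_pos _).ne'
    simp only [deriv_circleMap, sub_zero, smul_eq_mul, hH]
    field_simp
  simp only at h1
  simp only [h1]
  have hper : Function.Periodic H (2*Real.pi) := by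
    intro θ
    simp only [hH]
    rw [periodic_circleMap]
  rw [intervalIntegral.integral_const_mul]
  have h2 : ∫ θ in (0:ℝ)..2*Real.pi, H θ = ∫ θ in (-Real.pi)..Real.pi, H θ := by
    have := hper.intervalIntegral_add_eq 0 (-Real.pi)
    rw [zero_add] at this
    rw [this]; congr 1; ring
  have h3 : ∫ τ in (-(Real.pi/(2*c)))..(Real.pi/(2*c)), 2 * (c:ℂ) * H ((-2*c) * τ) = ∫ θ in (-Real.pi)..Real.pi, H θ := by
    rw [intervalIntegral.integral_const_mul, intervalIntegral.integral_comp_mul_left _ (by linarith)]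
    rw [show -2*c * -(Real.pi/(2*c)) = Real.pi by field_simp, show -2*c * (Real.pi/(2*c)) = -Real.pi by field_simp,
      intervalIntegral.integral_symm, Complex.real_smul]
    have : (c:ℂ) ≠ 0 := by exact_mod_cast hc.ne'
    push_cast; field_simp
  rw [h2, ← h3, smul_eq_mul]
  have hpi : (Real.pi:ℂ) ≠ 0 := by exact_mod_cast Real.pi_ne_zero
  have h4 : ∀ τ : ℝ, FN (n+1) κ c τ = 2 * Complex.exp (-(2 * ((n+1:ℕ):ℂ) * κ)) * (2 * (c:ℂ) * H ((-2*c) * τ)) := by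
    intro τ
    have := FN_pt n κ (wz c τ) c (by simp [wz, hc])
    rw [FN, ← this]
    have hcm : circleMap 0 (Real.exp (-2*c)) (-2*c*τ) = Complex.exp (-2 * wz c τ) := by
      rw [circleMap, wz, Complex.ofReal_exp, zero_add, ← Complex.exp_add]; congr 1; push_cast; ring
    simp only [hH, hcm]
  simp only [h4]
  rw [intervalIntegral.integral_const_mul (2 * Complex.exp (-(2 * ((n+1:ℕ):ℂ) * κ))) (fun τ : ℝ => 2 * (c:ℂ) * H ((-2*c) * τ))]
  generalize (∫ τ in (-(Real.pi/(2*c)))..(Real.pi/(2*c)), 2 * (c:ℂ) * H ((-2*c) * τ)) = J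
  have := Complex.I_ne_zero
  field_simp

/-! ### Bounds -/

theorem sinh_ab (a b : ℝ) : Complex.sinh ((a:ℂ) + b * Complex.I) =
    ((Real.sinh a * Real.cos b : ℝ):ℂ) + ((Real.cosh a * Real.sin b : ℝ):ℂ) * Complex.I := by
  rw [Complex.sinh_add, Complex.sinh_mul_I, Complex.cosh_mul_I]; push_cast; ring

theorem cosh_ab (a b : ℝ) : Complex.cosh ((a:ℂ) + b * Complex.I) =
    ((Real.cosh a * Real.cos b : ℝ):ℂ) + ((Real.sinh a * Real.sin b : ℝ):ℂ) * Complex.I := by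
  rw [Complex.cosh_add, Complex.sinh_mul_I, Complex.cosh_mul_I]; push_cast; ring

theorem tanh_re (a b : ℝ) : (Complex.tanh ((a:ℂ) + b * Complex.I)).re =
    Real.sinh a * Real.cosh a / (Real.cosh a^2 - Real.sin b^2) := by
  rw [Complex.tanh_eq_sinh_div_cosh, sinh_ab, cosh_ab, Complex.div_re, Complex.normSq_add_mul_I, ← add_div]
  have h1 := Real.cosh_sq a
  have h2 := Real.sin_sq_add_cos_sq b
  congr 1
  · simp only [Complex.add_re, Complex.add_im, Complex.mul_re, Complex.mul_im, Complex.ofReal_re, Complex.ofReal_im, Complex.I_re, Complex.I_im]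
    linear_combination (Real.sinh a * Real.cosh a) * h2
  · linear_combination (Real.cosh a ^2) * h2 - (Real.sin b ^2) * h1

theorem re_bound (κ c b : ℝ) (hκ : 1 ≤ κ) (hc : 0 < c) (hc1 : c ≤ 1) (hb : |b| ≤ Real.pi/2) :
    (((c:ℂ) + b * Complex.I) - κ * Complex.tanh ((c:ℂ) + b * Complex.I)).re ≤
      c * (4 * c^2 - (2/Real.pi*|b|)^2) - (κ-1) * (c/5) := by
  have hre : (((c:ℂ) + b * Complex.I) - κ * Complex.tanh ((c:ℂ) + b * Complex.I)).re =
    c - κ * (Real.sinh c * Real.cosh c / (Real.cosh c^2 - Real.sin b^2)) := by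
    rw [← tanh_re]; simp
  rw [hre]
  have hs : c ≤ Real.sinh c := Real.self_le_sinh_iff.2 hc.le
  have hch : 1 ≤ Real.cosh c := Real.one_le_cosh c
  have hsq : Real.cosh c^2 = Real.sinh c^2 + 1 := Real.cosh_sq c
  have hs2 : Real.sinh c ≤ 2*c := by
    have h1 := abs_le.1 (Real.abs_exp_sub_one_sub_id_le (x := c) (by rw [abs_of_pos hc]; exact hc1))
    have h2 := abs_le.1 (Real.abs_exp_sub_one_sub_id_le (x := -c) (by rw [abs_neg, abs_of_pos hc]; exact hc1))
    rw [Real.sinh_eq]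
    nlinarith
  have hsin : (2/Real.pi*|b|)^2 ≤ Real.sin b^2 := by
    rw [← sq_abs (Real.sin b)]
    have := Real.mul_abs_le_abs_sin hb
    have := Real.pi_pos
    gcongr
  have hsin1 : Real.sin b ^2 ≤ 1 := Real.sin_sq_le_one b
  set D := Real.cosh c^2 - Real.sin b^2 with hD
  have hDpos : 0 < D := by nlinarith
  have hD5 : D ≤ 5 := by nlinarith [sq_nonneg (Real.sin b)]
  have hT : c / D ≤ Real.sinh c * Real.cosh c / D := by
    gcongr; nlinarith
  have hT5 : c/5 ≤ c/D := by gcongr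
  have hcD : c - c/D ≤ c * (D - 1) := by
    have : c * (D-1) - (c - c/D) = c * (D-1)^2/D := by field_simp
    have : 0 ≤ c * (D-1)^2/D := by positivity
    linarith
  have hD1 : D - 1 ≤ 4*c^2 - (2/Real.pi*|b|)^2 := by nlinarith
  have := mul_le_mul_of_nonneg_left hD1 hc.le
  have hk : (κ-1) * (c/5) ≤ (κ-1) * (Real.sinh c * Real.cosh c / D) :=
    mul_le_mul_of_nonneg_left (by linarith) (by linarith)
  linarith

theorem sinh_bound (c b : ℝ) (hc : 0 < c) :
    ‖2 * (c:ℂ) / Complex.sinh (2 * ((c:ℂ) + b * Complex.I))‖ ≤ 1 := by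
  rw [norm_div]
  have h2 : 2 * ((c:ℂ) + b * Complex.I) = ((2*c:ℝ):ℂ) + ((2*b:ℝ):ℂ) * Complex.I := by push_cast; ring
  have h1 : ‖2 * (c:ℂ)‖ = 2*c := by simp [abs_of_pos hc]
  have hs : 2*c ≤ Real.sinh (2*c) := Real.self_le_sinh_iff.2 (by linarith)
  have hn : 2*c ≤ ‖Complex.sinh (2 * ((c:ℂ) + b * Complex.I))‖ := by
    refine le_of_sq_le_sq ?_ (norm_nonneg _)
    rw [← Complex.normSq_eq_norm_sq, h2, sinh_ab, Complex.normSq_add_mul_I]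
    have h3 := Real.sin_sq_add_cos_sq (2*b)
    have h4 := Real.cosh_sq (2*c)
    have : (Real.sinh (2*c) * Real.cos (2*b))^2 + (Real.cosh (2*c) * Real.sin (2*b))^2 = Real.sinh (2*c)^2 + Real.sin (2*b)^2 := by
      linear_combination (Real.sinh (2*c)^2) * h3 + (Real.sin (2*b)^2) * h4
    rw [this]
    nlinarith [sq_nonneg (Real.sin (2*b))]
  rw [h1]
  exact div_le_one_of_le₀ hn (norm_nonneg _)

theorem FN_bound (N : ℕ) (κ c τ : ℝ) (hκ : 1 ≤ κ) (hc : 0 < c) (hc1 : c ≤ 1) (hN : 2 * N * c^3 = 1)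
    (hτ : |τ| ≤ Real.pi/(2*c)) :
    ‖FN N κ c τ‖ ≤ Real.exp (-((κ-1) * (2 * N * c / 5))) * Real.exp (4 - (2/Real.pi)^2 * τ^2) := by
  have hw : wz c τ = (c:ℂ) + ((c*τ:ℝ):ℂ) * Complex.I := by rw [wz]; push_cast; ring
  have hb : |c*τ| ≤ Real.pi/2 := by
    rw [abs_mul, abs_of_pos hc]
    calc c * |τ| ≤ c * (Real.pi/(2*c)) := by gcongr
      _ = _ := by field_simp
  rw [FN, norm_mul, hw]
  refine (mul_le_of_le_one_right (norm_nonneg _) (sinh_bound c (c*τ) hc)).trans ?_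
  rw [Complex.norm_exp, ← Real.exp_add]
  apply Real.exp_le_exp.2
  have h := re_bound κ c (c*τ) hκ hc hc1 hb
  have h2 : (2 * (N:ℂ) * (((c:ℂ) + ((c*τ:ℝ):ℂ) * Complex.I) - κ * Complex.tanh ((c:ℂ) + ((c*τ:ℝ):ℂ) * Complex.I))).re
    = 2 * N * (((c:ℂ) + ((c*τ:ℝ):ℂ) * Complex.I) - κ * Complex.tanh ((c:ℂ) + ((c*τ:ℝ):ℂ) * Complex.I)).re := by
    rw [← Complex.re_ofReal_mul]; push_cast; rfl
  rw [h2]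
  refine (mul_le_mul_of_nonneg_left h (by positivity)).trans (le_of_eq ?_)
  have h3 : |c*τ|^2 = c^2*τ^2 := by rw [sq_abs]; ring
  rw [mul_pow, h3]
  linear_combination (4 - (2/Real.pi)^2 * τ^2) * hN

theorem FN_meas (N : ℕ) (κ c : ℝ) : Measurable (FN N κ c) := by
  unfold FN wz
  simp only [Complex.tanh_eq_sinh_div_cosh]
  have h1 := Complex.measurable_sinh
  have h2 := Complex.measurable_cosh
  have h3 := Complex.measurable_exp
  fun_prop

theorem dom_int : Integrable (fun τ : ℝ => Real.exp (4 - (2/Real.pi)^2 * τ^2)) := by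
  have := (integrable_exp_neg_mul_sq (b := (2/Real.pi)^2) (by have := Real.pi_pos; positivity)).const_mul (Real.exp 4)
  convert! this using 1
  ext τ
  rw [← Real.exp_add]; congr 1; ring

/-! ### Pointwise limits -/

open Topology Asymptotics in
theorem tanh_lim : Tendsto (fun w : ℂ => (w - Complex.tanh w)/w^3) (𝓝[≠] 0) (𝓝 (1/3)) := by
  have r1 := Complex.exp_sub_sum_range_succ_isLittleO_pow 3
  have r2 : (fun w : ℂ => Complex.exp (-w) - ∑ i ∈ Finset.range 4, (-w)^i/i.factorial) =o[𝓝 0] (fun w => w^3) := by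
    have : Tendsto (fun w : ℂ => -w) (𝓝 0) (𝓝 0) := by
      have := (continuous_neg (G := ℂ)).tendsto 0
      simpa using this
    have h := r1.comp_tendsto this
    refine h.trans_isBigO (IsBigO.of_bound 1 ?_)
    filter_upwards with w
    simp
  have hb : (fun w : ℂ => w) =O[𝓝 0] (fun _ => (1:ℂ)) := by
    refine IsBigO.of_bound 1 ?_
    filter_upwards [Metric.ball_mem_nhds (0:ℂ) one_pos] with w hw
    have : ‖w‖ < 1 := by simpa using hw
    simp; linarith
  have r3 : (fun w : ℂ => w * Complex.cosh w - Complex.sinh w - w^3/3) =o[𝓝 0] (fun w => w^3) := by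
    have a := (hb.mul_isLittleO (r1.add r2)).const_mul_left (1/2)
    have b := (r1.sub r2).const_mul_left (1/2)
    simp only [one_mul] at a
    refine (a.sub b).congr_left ?_
    intro w
    simp only [Finset.sum_range_succ, Finset.sum_range_zero, Complex.cosh, Complex.sinh, Nat.factorial]
    push_cast
    ring
  have r4 : Tendsto (fun w : ℂ => (w * Complex.cosh w - Complex.sinh w - w^3/3)/w^3) (𝓝[≠] 0) (𝓝 0) :=
    (r3.tendsto_div_nhds_zero).mono_left nhdsWithin_le_nhds
  have r5 : Tendsto (fun w : ℂ => Complex.cosh w) (𝓝[≠] 0) (𝓝 1) := by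
    have := Complex.continuous_cosh.tendsto 0
    rw [Complex.cosh_zero] at this
    exact this.mono_left nhdsWithin_le_nhds
  have r6 := (r4.add_const (1/3)).div r5 one_ne_zero
  rw [zero_add, div_one] at r6
  refine r6.congr' ?_
  filter_upwards [self_mem_nhdsWithin, r5.eventually_ne one_ne_zero] with w hw hcw
  have hw : w ≠ 0 := hw
  rw [Complex.tanh_eq_sinh_div_cosh]
  simp only [Pi.div_apply]
  field_simp
  ring

open Topology in
theorem sinh_lim : Tendsto (fun w : ℂ => w / Complex.sinh w) (𝓝[≠] 0) (𝓝 1) := by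
  have h := (Complex.hasDerivAt_sinh 0).tendsto_slope
  rw [Complex.cosh_zero] at h
  have h2 := h.inv₀ one_ne_zero
  rw [inv_one] at h2
  refine h2.congr ?_
  intro w
  rw [slope_def_field]; simp

open Topology in
theorem FN_lim (c : ℕ → ℝ) (hc : ∀ᶠ N in atTop, 0 < c N ∧ 2 * N * c N^3 = 1) (hc0 : Tendsto c atTop (𝓝 0)) (τ : ℝ) :
    Tendsto (fun N : ℕ => FN N 1 (c N) τ) atTop
      (𝓝 (Complex.exp ((1 + τ * Complex.I)^3/3) * (1/(1+τ*Complex.I)))) := by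
  set ζ : ℂ := 1 + τ * Complex.I with hζ
  have hζ0 : ζ ≠ 0 := by
    intro h; have := congrArg Complex.re h; simp [hζ] at this
  have hw : Tendsto (fun N => wz (c N) τ) atTop (𝓝[≠] 0) := by
    refine tendsto_nhdsWithin_iff.2 ⟨?_, ?_⟩
    · have : Tendsto (fun N => ((c N:ℝ):ℂ) * ζ) atTop (𝓝 (((0:ℝ):ℂ) * ζ)) :=
        ((Complex.continuous_ofReal.tendsto 0).comp hc0).mul_const ζ
      rw [Complex.ofReal_zero, zero_mul] at this
      exact this
    · filter_upwards [hc] with N hN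
      exact mul_ne_zero (by exact_mod_cast hN.1.ne') hζ0
  have hw2 : Tendsto (fun N => 2 * wz (c N) τ) atTop (𝓝[≠] 0) := by
    refine tendsto_nhdsWithin_iff.2 ⟨?_, ?_⟩
    · have := (tendsto_nhdsWithin_iff.1 hw).1.const_mul 2
      simpa using this
    · filter_upwards [(tendsto_nhdsWithin_iff.1 hw).2] with N hN
      exact mul_ne_zero two_ne_zero hN
  have h1 := ((tanh_lim.comp hw).const_mul (ζ^3)).cexp
  have h2 := (sinh_lim.comp hw2).mul_const (1/ζ)
  have h3 := h1.mul h2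
  rw [one_mul, show ζ^3 * (1/3) = ζ^3/3 by ring] at h3
  refine h3.congr' ?_
  filter_upwards [hc] with N hN
  have hcN : (c N : ℂ) ≠ 0 := by exact_mod_cast hN.1.ne'
  have hcN3 : 2 * (N:ℂ) * (c N:ℂ)^3 = 1 := by exact_mod_cast hN.2
  have hwz : wz (c N) τ = c N * ζ := rfl
  simp only [Function.comp_apply, FN]
  rw [hwz]
  have e1 : ζ^3 * (((c N:ℂ) * ζ - Complex.tanh ((c N:ℂ) * ζ)) / ((c N:ℂ) * ζ)^3) =
      2 * N * ((c N:ℂ) * ζ - ((1:ℝ):ℂ) * Complex.tanh ((c N:ℂ) * ζ)) := by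
    rw [Complex.ofReal_one, one_mul]
    generalize Complex.tanh ((c N:ℂ) * ζ) = T
    field_simp
    linear_combination (-((c N : ℂ) * ζ - T)) * hcN3
  have e2 : 2 * ((c N:ℂ) * ζ) / Complex.sinh (2 * ((c N:ℂ) * ζ)) * (1/ζ) = 2 * (c N:ℂ) / Complex.sinh (2 * ((c N:ℂ) * ζ)) := by
    generalize Complex.sinh (2 * ((c N:ℂ) * ζ)) = T
    field_simp
  rw [e1, e2]

/-! ### Airy function -/

noncomputable def aF (u t : ℝ) : ℂ :=
  Complex.exp ((1 + (t:ℂ)*Complex.I)^3/3 - (u:ℂ)*(1 + (t:ℂ)*Complex.I))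

theorem aF_norm (u t : ℝ) : ‖aF u t‖ = Real.exp (-u) * Real.exp (1/3 - t^2) := by
  rw [aF, Complex.norm_exp, ← Real.exp_add]
  congr 1
  have : (1 + (t:ℂ)*Complex.I)^3/3 - (u:ℂ)*(1 + (t:ℂ)*Complex.I) =
      ((1/3 - t^2 - u : ℝ):ℂ) + ((t - t^3/3 - u*t : ℝ):ℂ) * Complex.I := by
    push_cast
    linear_combination ((t:ℂ)^2 + (t:ℂ)^3/3 * Complex.I) * Complex.I_sq
  rw [this]
  simp only [Complex.add_re, Complex.mul_re, Complex.ofReal_re, Complex.ofReal_im, Complex.I_re, Complex.I_im]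
  ring

theorem aF_cont : Continuous (fun q : ℝ × ℝ => aF q.1 q.2) := by
  unfold aF; fun_prop

theorem g_int : Integrable (fun t : ℝ => Real.exp (1/3 - t^2)) := by
  have := (integrable_exp_neg_mul_sq (b := 1) one_pos).const_mul (Real.exp (1/3))
  convert! this using 1
  ext τ
  rw [← Real.exp_add]; congr 1; ring

theorem AiryC_eq (u : ℝ) : AiryC u = (1 / (2 * (Real.pi : ℂ))) * ∫ t : ℝ, aF u t := rfl

theorem AiryC_conj (u : ℝ) : (starRingEnd ℂ) (AiryC u) = AiryC u := by
  rw [AiryC_eq, map_mul, ← integral_conj, ← integral_neg_eq_self (fun t => (starRingEnd ℂ) (aF u t))]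
  congr 1
  · simp only [map_div₀, map_mul, map_one, Complex.conj_ofReal]
    rw [show (starRingEnd ℂ) (2:ℂ) = 2 from map_ofNat (starRingEnd ℂ) 2]
  · congr 1
    ext t
    rw [aF, aF, ← Complex.exp_conj]
    congr 1
    simp only [map_sub, map_div₀, map_pow, map_mul, map_add, map_one, Complex.conj_ofReal, Complex.conj_I]
    rw [show (starRingEnd ℂ) (3:ℂ) = 3 from map_ofNat (starRingEnd ℂ) 3]
    push_cast
    ring

theorem AiryR_eq (u : ℝ) : (AiryR u : ℂ) = AiryC u := by
  rw [AiryR]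
  exact Complex.conj_eq_iff_re.1 (AiryC_conj u)

theorem AiryC_bound : ∃ C : ℝ, 0 ≤ C ∧ ∀ u : ℝ, ‖AiryC u‖ ≤ C * Real.exp (-u) := by
  refine ⟨‖(1 / (2 * (Real.pi : ℂ)))‖ * ∫ t : ℝ, Real.exp (1/3 - t^2), ?_, ?_⟩
  · have : 0 ≤ ∫ t : ℝ, Real.exp (1/3 - t^2) := integral_nonneg (fun t => (Real.exp_pos _).le)
    positivity
  · intro u
    rw [AiryC_eq, norm_mul, mul_assoc]
    gcongr
    refine (norm_integral_le_integral_norm _).trans (le_of_eq ?_)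
    simp only [aF_norm]
    rw [integral_const_mul, mul_comm]

theorem Ai1_bound : ∃ C : ℝ, ∀ ξ : ℝ, ‖Ai1 ξ‖ ≤ C * Real.exp (-ξ) := by
  obtain ⟨C, _, h⟩ := AiryC_bound
  refine ⟨C, fun ξ => ?_⟩
  rw [Ai1, ← integral_exp_neg_Ioi ξ, ← integral_const_mul]
  refine norm_integral_le_of_norm_le ((integrableOn_exp_neg_Ioi ξ).const_mul C) ?_
  filter_upwards with u
  rw [← Complex.norm_real, AiryR_eq]
  exact h u

theorem Ai1_zero : (Ai1 0 : ℂ) = (1 / (2 * (Real.pi : ℂ))) *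
    ∫ t : ℝ, Complex.exp ((1 + (t:ℂ)*Complex.I)^3/3) * (1/(1 + (t:ℂ)*Complex.I)) := by
  rw [Ai1, ← integral_complex_ofReal]
  simp only [AiryR_eq, AiryC_eq]
  rw [integral_const_mul]
  congr 1
  rw [integral_integral_swap]
  · congr 1
    ext t
    have hre : (-(1 + (t:ℂ)*Complex.I)).re < 0 := by simp
    have h := integral_exp_mul_complex_Ioi hre 0
    have h2 : ∀ u : ℝ, aF u t = Complex.exp ((1 + (t:ℂ)*Complex.I)^3/3) * Complex.exp (-(1 + (t:ℂ)*Complex.I) * u) := by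
      intro u; rw [aF, ← Complex.exp_add]; congr 1; ring
    simp only [h2]
    rw [integral_const_mul, h]
    congr 1
    simp only [Complex.ofReal_zero, mul_zero, Complex.exp_zero]
    rw [neg_div_neg_eq]
  · have h := Integrable.mul_prod (integrableOn_exp_neg_Ioi 0) g_int
    refine h.mono' aF_cont.aestronglyMeasurable ?_
    filter_upwards with q
    exact (aF_norm q.1 q.2).le

/-! ### Conclusion -/

noncomputable def cN (N : ℕ) : ℝ := (2*(N:ℝ)) ^ (-(1:ℝ)/3)

theorem cN_pos (N : ℕ) (hN : 1 ≤ N) : 0 < cN N := by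
  have : (1:ℝ) ≤ N := by exact_mod_cast hN
  unfold cN; positivity

theorem cN_le (N : ℕ) (hN : 1 ≤ N) : cN N ≤ 1 := by
  have : (1:ℝ) ≤ N := by exact_mod_cast hN
  exact Real.rpow_le_one_of_one_le_of_nonpos (by linarith) (by norm_num)

theorem cN_cube (N : ℕ) (hN : 1 ≤ N) : 2 * N * cN N^3 = 1 := by
  have : (1:ℝ) ≤ N := by exact_mod_cast hN
  unfold cN
  rw [← Real.rpow_natCast, ← Real.rpow_mul (by positivity)]
  norm_num
  rw [Real.rpow_neg_one]
  field_simp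

theorem cN_two (N : ℕ) (hN : 1 ≤ N) : 2 * N * cN N = (2*(N:ℝ)) ^ ((2:ℝ)/3) := by
  have : (1:ℝ) ≤ N := by exact_mod_cast hN
  unfold cN
  nth_rw 1 [← Real.rpow_one (2*(N:ℝ))]
  rw [← Real.rpow_add (by positivity)]
  norm_num

theorem twoN_tendsto : Tendsto (fun N : ℕ => 2 * (N:ℝ)) atTop atTop :=
  tendsto_natCast_atTop_atTop.const_mul_atTop two_pos

theorem cN_tendsto : Tendsto cN atTop (nhds 0) := by
  have := (tendsto_rpow_neg_atTop (y := 1/3) (by norm_num)).comp twoN_tendsto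
  convert! this using 1
  ext N
  simp only [cN, Function.comp_apply]
  norm_num

theorem powN_tendsto : Tendsto (fun N : ℕ => (2*(N:ℝ)) ^ ((2:ℝ)/3)) atTop atTop :=
  (tendsto_rpow_atTop (by norm_num)).comp twoN_tendsto

noncomputable def GN (κ : ℝ) (N : ℕ) : ℝ → ℂ :=
  (Set.Ioc (-(Real.pi/(2*cN N))) (Real.pi/(2*cN N))).indicator (FN N κ (cN N))

theorem sigma_final (μ : ℝ) (hμ : 0 < μ) (x p : ℝ) (N : ℕ) (hN : 1 ≤ N) :
    sigmaP (μ / N) N x p = (1 / (2 * (Real.pi:ℂ))) * ∫ τ : ℝ, GN ((x^2+p^2)/(2*μ)) N τ := by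
  have hNp : (0:ℝ) < N := by exact_mod_cast hN
  rw [sigmaP_eq _ (by positivity)]
  obtain ⟨n, rfl⟩ : ∃ n, N = n + 1 := ⟨N-1, by omega⟩
  have h := S_integral n ((x^2+p^2)/(2*μ)) (cN (n+1)) (cN_pos _ hN)
  have hle : -(Real.pi/(2*cN (n+1))) ≤ Real.pi/(2*cN (n+1)) := by
    have := cN_pos _ hN
    have : 0 < Real.pi/(2*cN (n+1)) := by have := Real.pi_pos; positivity
    linarith
  unfold GN
  rw [integral_indicator measurableSet_Ioc, ← intervalIntegral.integral_of_le hle, ← h]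
  have e1 : (x^2+p^2)/(μ/((n+1:ℕ):ℝ)) = 2 * ((n+1:ℕ):ℝ) * ((x^2+p^2)/(2*μ)) := by
    field_simp
  rw [e1]
  have e2 : ((2 * (2 * ((n+1:ℕ):ℝ) * ((x^2+p^2)/(2*μ))) : ℝ):ℂ) = 4 * ((n+1:ℕ):ℂ) * (((x^2+p^2)/(2*μ) : ℝ):ℂ) := by
    push_cast; ring
  rw [e2]
  push_cast
  rfl

theorem GN_bound (κ : ℝ) (hκ : 1 ≤ κ) (N : ℕ) (hN : 1 ≤ N) (τ : ℝ) :
    ‖GN κ N τ‖ ≤ Real.exp (-((κ-1) * ((2*(N:ℝ)) ^ ((2:ℝ)/3) / 5))) * Real.exp (4 - (2/Real.pi)^2 * τ^2) := by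
  unfold GN
  rw [← cN_two N hN]
  by_cases h : τ ∈ Set.Ioc (-(Real.pi/(2*cN N))) (Real.pi/(2*cN N))
  · rw [Set.indicator_of_mem h]
    exact FN_bound N κ (cN N) τ hκ (cN_pos N hN) (cN_le N hN) (cN_cube N hN) (abs_le.2 ⟨h.1.le, h.2⟩)
  · rw [Set.indicator_of_notMem h, norm_zero]; positivity

theorem GN_meas (κ : ℝ) (N : ℕ) : Measurable (GN κ N) :=
  (FN_meas N κ (cN N)).indicator measurableSet_Ioc

theorem GN_lim (τ : ℝ) : Tendsto (fun N : ℕ => GN 1 N τ) atTop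
      (nhds (Complex.exp ((1 + τ * Complex.I)^3/3) * (1/(1+τ*Complex.I)))) := by
  have hc : ∀ᶠ N in atTop, 0 < cN N ∧ 2 * N * cN N^3 = 1 := by
    filter_upwards [eventually_ge_atTop 1] with N hN using ⟨cN_pos N hN, cN_cube N hN⟩
  refine (FN_lim cN hc cN_tendsto τ).congr' ?_
  have hsm : ∀ᶠ N in atTop, cN N < 1/(|τ|+1) := cN_tendsto.eventually_lt_const (by positivity)
  filter_upwards [hc, hsm] with N h1 h2
  have h3 : |τ| + 1 < 1/cN N := by
    rw [lt_div_iff₀ (by positivity)] at h2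
    rw [lt_div_iff₀ h1.1]; linarith
  have h4 : 1/cN N ≤ Real.pi/(2*cN N) := by
    have := Real.pi_gt_three
    have := h1.1
    rw [div_le_div_iff₀ (by positivity) (by positivity)]
    nlinarith
  have h5 := abs_lt.1 (show |τ| < Real.pi/(2*cN N) by linarith)
  unfold GN
  rw [Set.indicator_of_mem (Set.mem_Ioc.2 ⟨h5.1, h5.2.le⟩)]

/-- Pointwise asymptotics of `σ_{P_{<N}}` in the classically forbidden region
`x² + p² ≥ 2μ`: the difference with the Airy-smoothed indicator tends to zero. -/
theorem pointwise_forbidden_sigmaP (μ : ℝ) (hμ : 0 < μ) (x p : ℝ)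
    (hxp : 2 * μ ≤ x ^ 2 + p ^ 2) :
    Tendsto (fun N : ℕ => sigmaP (μ / N) N x p - ((chiDN μ N x p : ℝ) : ℂ))
      atTop (nhds 0) := by
  set κ := (x^2+p^2)/(2*μ) with hκd
  have hκ : 1 ≤ κ := by rw [hκd, le_div_iff₀ (by positivity)]; linarith
  have harg : ∀ N : ℕ, chiDN μ N x p = Ai1 ((2*(N:ℝ)) ^ ((2:ℝ)/3) * (κ-1)) := by
    intro N
    rw [chiDN, mul_div_assoc]
    congr 2
    rw [hκd]; field_simp
  have hsig : ∀ᶠ N : ℕ in atTop, (1 / (2 * (Real.pi:ℂ))) * ∫ τ : ℝ, GN κ N τ = sigmaP (μ / N) N x p := by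
    filter_upwards [eventually_ge_atTop 1] with N hN
    exact (sigma_final μ hμ x p N hN).symm
  rcases hκ.eq_or_lt with h1 | h1
  · have hchi : ∀ N : ℕ, chiDN μ N x p = Ai1 0 := by
      intro N; rw [harg, ← h1]; simp
    simp only [hchi]
    rw [← sub_self ((Ai1 0 : ℝ):ℂ)]
    refine Tendsto.sub_const ?_ _
    refine Tendsto.congr' hsig ?_
    rw [Ai1_zero, ← h1]
    refine Tendsto.const_mul _ ?_
    refine tendsto_integral_filter_of_dominated_convergence
      (fun τ : ℝ => Real.exp (4 - (2/Real.pi)^2 * τ^2)) ?_ ?_ dom_int ?_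
    · exact Eventually.of_forall fun N => (GN_meas 1 N).aestronglyMeasurable
    · filter_upwards [eventually_ge_atTop 1] with N hN
      filter_upwards with τ
      have := GN_bound 1 le_rfl N hN τ
      simpa using this
    · filter_upwards with τ using GN_lim τ
  · have hpow : Tendsto (fun N : ℕ => (2*(N:ℝ)) ^ ((2:ℝ)/3) * (κ-1)) atTop atTop :=
      powN_tendsto.atTop_mul_const (by linarith)
    rw [← sub_zero (0:ℂ)]
    refine Tendsto.sub ?_ ?_
    · refine Tendsto.congr' hsig ?_
      rw [← mul_zero (1 / (2 * (Real.pi:ℂ)))]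
      refine Tendsto.const_mul _ ?_
      have hb : Tendsto (fun N : ℕ => Real.exp (-((κ-1) * ((2*(N:ℝ)) ^ ((2:ℝ)/3) / 5))) *
          ∫ τ : ℝ, Real.exp (4 - (2/Real.pi)^2 * τ^2)) atTop (nhds 0) := by
        rw [← zero_mul (∫ τ : ℝ, Real.exp (4 - (2/Real.pi)^2 * τ^2))]
        refine Tendsto.mul_const _ (Real.tendsto_exp_neg_atTop_nhds_zero.comp ?_)
        have := hpow.atTop_div_const (show (0:ℝ) < 5 by norm_num)
        convert! this using 1
        ext N; ring
      refine squeeze_zero_norm' ?_ hb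
      filter_upwards [eventually_ge_atTop 1] with N hN
      rw [← integral_const_mul]
      exact norm_integral_le_of_norm_le (dom_int.const_mul _) (Eventually.of_forall fun τ => GN_bound κ hκ N hN τ)
    · obtain ⟨C, hC⟩ := Ai1_bound
      have hb : Tendsto (fun N : ℕ => C * Real.exp (-((2*(N:ℝ)) ^ ((2:ℝ)/3) * (κ-1)))) atTop (nhds 0) := by
        rw [← mul_zero C]
        exact (Real.tendsto_exp_neg_atTop_nhds_zero.comp hpow).const_mul C
      refine squeeze_zero_norm (fun N => ?_) hb
      rw [Complex.norm_real, harg]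
      exact hC _
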